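/- arXiv:2601.03934 — 6 statements merged into one kernel-verified Lean document; each statement's English description precedes it below -/
import Mathlib

section
/- Let G = (V, E) be a finite connected simple graph and t ∈ V a target vertex. There exists an in-port oblivious local forwarding pattern that is perfectly resilient for t if and only if every simple cycle of G has length at most 3. -/
open Classical

namespace FRR

variable {V : Type*}

/-- A forwarding function: given a failure scenario, the current vertex and an in-port,
return the link along which the packet is forwarded. -/
abbrev Fwd (V : Type*) := Set (Sym2 V) → V → Sym2 V → Sym2 V

/-- `ρ` is a forwarding pattern for `G`: at each vertex it returns an incident link
(or the self-loop `s(v, v)`, which models staying at `v`), and whenever not all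
incident links have failed, the returned link is active (not failed). -/
def IsFwdPattern (G : SimpleGraph V) (ρ : Fwd V) : Prop :=
  ∀ F ⊆ G.edgeSet, ∀ (v : V) (e : Sym2 V),
    ρ F v e ∈ G.incidenceSet v ∪ {s(v, v)} ∧
    (¬ G.incidenceSet v ⊆ F → ρ F v e ∉ F)

/-- `ρ` is local: its decisions only depend on the locally visible failed links. -/
def IsLocal (G : SimpleGraph V) (ρ : Fwd V) : Prop :=
  ∀ F ⊆ G.edgeSet, ∀ F' ⊆ G.edgeSet, ∀ v : V,
    F ∩ G.incidenceSet v = F' ∩ G.incidenceSet v → ∀ e : Sym2 V, ρ F v e = ρ F' v e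

/-- `ρ` is in-port oblivious: at every vertex and in every failure scenario its
decision does not depend on the in-port. -/
def InPortOblivious (G : SimpleGraph V) (ρ : Fwd V) : Prop :=
  ∀ F ⊆ G.edgeSet, ∀ (v : V) (e e' : Sym2 V), ρ F v e = ρ F v e'

/-- The endpoint of `e` other than `v` (or `v` itself if `v ∉ e`). -/
noncomputable def step (v : V) (e : Sym2 V) : V :=
  if h : v ∈ e then Sym2.Mem.other h else v

/-- `route ρ F s₀ n = (π_n, π_{n+1})` where `π` is the routing determined by `ρ`,
the start vertex `s₀` and the failure scenario `F`; that is, `π_0 = π_1 = s₀`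
(injection is modeled by the in-port `s(s₀, s₀)`) and
`ρ_{π_i}^F s(π_{i-1}, π_i) = s(π_i, π_{i+1})` for `i ≥ 1`. -/
noncomputable def route (ρ : Fwd V) (F : Set (Sym2 V)) (s₀ : V) : ℕ → V × V
  | 0 => (s₀, s₀)
  | n + 1 =>
    ((route ρ F s₀ n).2,
      step (route ρ F s₀ n).2
        (ρ F (route ρ F s₀ n).2 s((route ρ F s₀ n).1, (route ρ F s₀ n).2)))

/-- The routing determined by `ρ`, `s₀` and `F` reaches `t`. -/
def Reaches (ρ : Fwd V) (F : Set (Sym2 V)) (s₀ t : V) : Prop :=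
  ∃ n : ℕ, (route ρ F s₀ n).1 = t

/-- `ρ` is perfectly resilient for the target `t` in `G`: for every failure scenario
and every start vertex still connected to `t` after the failures, the routing
reaches `t`. -/
def PerfectlyResilient (G : SimpleGraph V) (ρ : Fwd V) (t : V) : Prop :=
  ∀ F ⊆ G.edgeSet, ∀ v : V, (G.deleteEdges F).Reachable v t → Reaches ρ F v t

/-- `L` is a skipping priority list for `G`: for every vertex and every in-port it is
a duplicate-free enumeration of all links incident to the vertex. -/
def IsSkipList (G : SimpleGraph V) (L : V → Sym2 V → List (Sym2 V)) : Prop :=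
  ∀ (v : V) (e : Sym2 V), (L v e).Nodup ∧ ∀ f : Sym2 V, f ∈ L v e ↔ f ∈ G.incidenceSet v

/-- The skipping forwarding pattern induced by a skipping priority list: forward
along the first link of the list that is not failed (staying at `v`, modeled by the
self-loop `s(v, v)`, if all incident links failed). -/
noncomputable def skipFwd (L : V → Sym2 V → List (Sym2 V)) : Fwd V :=
  fun F v e =>
    match (L v e).find? (fun f => decide (f ∉ F)) with
    | some f => f
    | none => s(v, v)

end FRR

namespace FRR

variable {V : Type*} {G : SimpleGraph V} {ρ : Fwd V} {F : Set (Sym2 V)} {t : V}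

/-- Forwarding to `w` from `v` along the link `s(v, w)`, including the self-loop. -/
lemma step_mk (v w : V) : step v s(v, w) = w := by
  have h : v ∈ s(v, w) := Sym2.mem_mk_left v w
  rw [step, dif_pos h]
  exact Sym2.congr_right.mp (Sym2.other_spec h)

/-- The next hop of an in-port oblivious forwarding pattern. -/
noncomputable def nextHop (ρ : Fwd V) (F : Set (Sym2 V)) (v : V) : V :=
  step v (ρ F v s(v, v))

lemma route_snd_eq_iterate (hF : ∀ (v : V) (e e' : Sym2 V), ρ F v e = ρ F v e') (s₀ : V) (n : ℕ) :
    (route ρ F s₀ n).2 = (nextHop ρ F)^[n] s₀ := by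
  induction n with
  | zero => rfl
  | succ n ih =>
    rw [Function.iterate_succ_apply', ← ih]
    exact congrArg (step (route ρ F s₀ n).2) (hF _ _ _)

lemma reaches_iff_exists_iterate (hF : ∀ (v : V) (e e' : Sym2 V), ρ F v e = ρ F v e') (s₀ : V) :
    Reaches ρ F s₀ t ↔ ∃ n, (nextHop ρ F)^[n] s₀ = t := by
  constructor
  · rintro ⟨n, hn⟩
    cases n with
    | zero => exact ⟨0, hn⟩
    | succ n => exact ⟨n, by rw [← route_snd_eq_iterate hF, ← hn]; rfl⟩
  · rintro ⟨n, hn⟩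
    exact ⟨n + 1, by rw [← hn, ← route_snd_eq_iterate hF]; rfl⟩

lemma IsFwdPattern.nextHop_eq_or (hρ : IsFwdPattern G ρ) (hF : F ⊆ G.edgeSet) {v w : V}
    (hvw : G.Adj v w) (hw : s(v, w) ∉ F) :
    nextHop ρ F v = v ∨ (G.Adj v (nextHop ρ F v) ∧ s(v, nextHop ρ F v) ∉ F) := by
  obtain ⟨hmem, hact⟩ := hρ F hF v s(v, v)
  have hact := hact fun h => hw (h (by simpa [SimpleGraph.incidenceSet] using hvw))
  rcases hmem with hmem | hmem
  · right
    obtain ⟨u, hu⟩ : ∃ u, ρ F v s(v, v) = s(v, u) := Sym2.mem_iff_exists.mp hmem.2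
    have hstep : nextHop ρ F v = u := by rw [nextHop, hu, step_mk]
    rw [hstep]
    rw [hu] at hmem hact
    exact ⟨hmem.1, hact⟩
  · left
    rw [nextHop, Set.mem_singleton_iff.mp hmem, step_mk]

/-- The links at `b` other than those to `a` and `c`, and the links at `c` other than the one
to `b`. -/
def isolatingFailures (G : SimpleGraph V) (a b c : V) : Set (Sym2 V) :=
  {e | e ∈ G.edgeSet ∧
    ((b ∈ e ∧ e ≠ s(b, a) ∧ e ≠ s(b, c)) ∨ (c ∈ e ∧ e ≠ s(b, c)))}

lemma isolatingFailures_subset (a b c : V) : isolatingFailures G a b c ⊆ G.edgeSet :=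
  fun _ h => h.1

lemma isolatingFailures_inter_incidenceSet {a b c : V} (hbc : b ≠ c) :
    isolatingFailures G a b c ∩ G.incidenceSet b =
      {e | e ∈ G.incidenceSet b ∧ e ≠ s(b, a) ∧ e ≠ s(b, c)} := by
  ext e
  constructor
  · rintro ⟨⟨_, h | h⟩, hb⟩
    · exact ⟨hb, h.2⟩
    · exact absurd ((Sym2.mem_and_mem_iff hbc).mp ⟨hb.2, h.1⟩) h.2
  · rintro ⟨hb, h⟩
    exact ⟨⟨hb.1, Or.inl ⟨hb.2, h⟩⟩, hb⟩

lemma PerfectlyResilient.nextHop_isolatingFailures (hres : PerfectlyResilient G ρ t)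
    (hpat : IsFwdPattern G ρ) (hobl : InPortOblivious G ρ) {a b c : V} (hba : G.Adj b a)
    (hbc : G.Adj b c) (hac : a ≠ c) (W : G.Walk a t) (hbW : b ∉ W.support) (hcW : c ∉ W.support) :
    nextHop ρ (isolatingFailures G a b c) b = a := by
  set F := isolatingFailures G a b c with hFdef
  have hF : F ⊆ G.edgeSet := isolatingFailures_subset a b c
  have hba' : s(b, a) ∉ F := by
    rintro ⟨_, h | h⟩
    · exact h.2.1 rfl
    · rcases Sym2.mem_iff.mp h.1 with h' | h'
      · exact hbc.ne h'.symm
      · exact hac h'.symm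
  have hbc' : s(b, c) ∉ F := by
    rintro ⟨_, h | h⟩
    · exact h.2.2 rfl
    · exact h.2 rfl
  by_contra hne
  have hb : nextHop ρ F b = b ∨ nextHop ρ F b = c := by
    rcases hpat.nextHop_eq_or hF hba hba' with h | ⟨hadj, hact⟩
    · exact Or.inl h
    · right
      by_contra hnc
      exact hact ⟨hadj, Or.inl ⟨Sym2.mem_mk_left _ _, fun h => hne (Sym2.congr_right.mp h),
        fun h => hnc (Sym2.congr_right.mp h)⟩⟩
  have hc : nextHop ρ F c = b ∨ nextHop ρ F c = c := by
    rcases hpat.nextHop_eq_or hF hbc.symm (by rwa [Sym2.eq_swap]) with h | ⟨hadj, hact⟩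
    · exact Or.inr h
    · left
      by_contra hnb
      refine hact ⟨hadj, Or.inr ⟨Sym2.mem_mk_left _ _, fun h => hnb ?_⟩⟩
      rw [Sym2.eq_swap (a := b)] at h
      exact Sym2.congr_right.mp h
  have hinv : ∀ n, (nextHop ρ F)^[n] b = b ∨ (nextHop ρ F)^[n] b = c := by
    intro n
    induction n with
    | zero => exact Or.inl rfl
    | succ n ih =>
      rw [Function.iterate_succ_apply']
      rcases ih with ih | ih <;> rw [ih]
      exacts [hb, hc]
  have hreach : (G.deleteEdges F).Reachable b t := by
    have hadj : (G.deleteEdges F).Adj b a := by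
      rw [SimpleGraph.deleteEdges_adj]
      exact ⟨hba, hba'⟩
    refine hadj.reachable.trans ⟨W.toDeleteEdges F fun e he => ?_⟩
    rintro ⟨_, h | h⟩
    · exact hbW (W.mem_support_of_mem_edges he h.1)
    · exact hcW (W.mem_support_of_mem_edges he h.1)
  obtain ⟨n, hn⟩ := (reaches_iff_exists_iterate (hobl F hF) b).mp (hres F hF b hreach)
  rcases hinv n with h | h
  · exact hbW (h ▸ hn ▸ W.end_mem_support)
  · exact hcW (h ▸ hn ▸ W.end_mem_support)

/-- A vertex with two neighbours, each of which has a route to the target avoiding the vertex and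
the other neighbour, obstructs in-port oblivious perfect resilience. -/
lemma not_perfectlyResilient_of_walks (hpat : IsFwdPattern G ρ) (hloc : IsLocal G ρ)
    (hobl : InPortOblivious G ρ) {a b c : V} (hba : G.Adj b a) (hbc : G.Adj b c) (hac : a ≠ c)
    (W : G.Walk a t) (hbW : b ∉ W.support) (hcW : c ∉ W.support)
    (W' : G.Walk c t) (hbW' : b ∉ W'.support) (haW' : a ∉ W'.support) :
    ¬ PerfectlyResilient G ρ t := by
  intro hres
  have ha := hres.nextHop_isolatingFailures hpat hobl hba hbc hac W hbW hcW
  have hc := hres.nextHop_isolatingFailures hpat hobl hbc hba hac.symm W' hbW' haW'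
  refine hac (ha.symm.trans (Eq.trans ?_ hc))
  refine congrArg (step b) (hloc _ (isolatingFailures_subset _ _ _) _
    (isolatingFailures_subset _ _ _) b ?_ _)
  rw [isolatingFailures_inter_incidenceSet hbc.ne, isolatingFailures_inter_incidenceSet hba.ne]
  ext e
  simp only [Set.mem_ofPred_eq, and_comm]

/-- A closest neighbour towards `t` exists. -/
lemma exists_adj_dist_add_one (hG : G.Connected) {v : V} (hv : v ≠ t) :
    ∃ w, G.Adj v w ∧ G.dist w t + 1 = G.dist v t := by
  obtain ⟨p, hp⟩ := hG.exists_walk_length_eq_dist v t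
  cases p with
  | nil => exact absurd rfl hv
  | @cons _ w _ h q =>
    refine ⟨w, h, ?_⟩
    have h1 := SimpleGraph.dist_le q
    have h2 := hG.dist_triangle (u := v) (v := w) (w := t)
    rw [SimpleGraph.dist_eq_one_iff_adj.mpr h] at h2
    rw [SimpleGraph.Walk.length_cons] at hp
    omega

/-- From every vertex there is a walk to `t` along which the distance to `t` drops below the
initial one. -/
lemma exists_walk_dist_lt (hG : G.Connected) (t v : V) :
    ∃ W : G.Walk v t, ∀ u ∈ W.support, u = v ∨ G.dist u t < G.dist v t := by
  induction h : G.dist v t using Nat.strong_induction_on generalizing v with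
  | _ d ih =>
    by_cases hv : v = t
    · subst hv
      exact ⟨.nil, fun u hu => Or.inl (by simpa using hu)⟩
    · obtain ⟨w, hvw, hd⟩ := exists_adj_dist_add_one hG hv
      obtain ⟨W, hW⟩ := ih (G.dist w t) (by omega) w rfl
      refine ⟨.cons hvw W, fun u hu => ?_⟩
      rw [SimpleGraph.Walk.support_cons, List.mem_cons] at hu
      refine hu.imp_right fun hu => ?_
      rcases hW u hu with rfl | h' <;> omega

/-- A cycle of length at least four contains a vertex with two routes to `t` that leave it through
distinct neighbours and avoid each other's first vertex. -/
lemma exists_walks_of_isCycle (hG : G.Connected) (t : V) {v : V} {p : G.Walk v v}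
    (hp : p.IsCycle) (hlen : 4 ≤ p.length) :
    ∃ a b c : V, G.Adj b a ∧ G.Adj b c ∧ a ≠ c ∧
      (∃ W : G.Walk a t, b ∉ W.support ∧ c ∉ W.support) ∧
      (∃ W : G.Walk c t, b ∉ W.support ∧ a ∉ W.support) := by
  obtain ⟨x, hx, hmin⟩ := p.support.toFinset.exists_min_image (fun u => G.dist u t)
    ⟨v, by simp⟩
  rw [List.mem_toFinset] at hx
  have hq : (p.rotate x hx).IsCycle := hp.rotate hx
  have hqlen : 4 ≤ (p.rotate x hx).length := by rwa [SimpleGraph.Walk.length_rotate]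
  have hqmin : ∀ u ∈ (p.rotate x hx).support, G.dist x t ≤ G.dist u t := fun u hu =>
    hmin u (List.mem_toFinset.mpr ((SimpleGraph.Walk.mem_support_rotate_iff ..).mp hu))
  generalize p.rotate x hx = q at hq hqlen hqmin
  obtain ⟨W, hW⟩ := exists_walk_dist_lt hG t x
  have hinj : ∀ i j, 1 ≤ i → i ≤ q.length → 1 ≤ j → j ≤ q.length → q.getVert i = q.getVert j →
      i = j := fun i j h1 h2 h3 h4 h => hq.getVert_injOn ⟨h1, h2⟩ ⟨h3, h4⟩ h
  have hWq : ∀ i, 1 ≤ i → i < q.length → q.getVert i ∉ W.support := by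
    intro i h1 h2 hi
    rcases hW _ hi with h | h
    · have := hinj i q.length h1 h2.le (by omega) le_rfl (by rw [h, q.getVert_length])
      omega
    · exact absurd h (not_lt.mpr (hqmin _ (q.getVert_mem_support i)))
  have h01 : G.Adj x (q.getVert 1) := by
    simpa using q.adj_getVert_succ (i := 0) (by omega)
  have hne : ∀ i, 2 ≤ i → i < q.length →
      q.getVert i ∉ (SimpleGraph.Walk.cons h01.symm W).support := by
    intro i h1 h2 hi
    rw [SimpleGraph.Walk.support_cons, List.mem_cons] at hi
    rcases hi with hi | hi
    · have := hinj i 1 (by omega) h2.le le_rfl (by omega) hi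
      omega
    · exact hWq i (by omega) h2 hi
  have hdrop : ∀ i, 1 ≤ i → i < 3 → q.getVert i ∉ ((q.drop 3).append W).support := by
    intro i h1 h2 hi
    rcases (SimpleGraph.Walk.mem_support_append_iff _ _).mp hi with hi | hi
    · obtain ⟨n, hn, hle⟩ := SimpleGraph.Walk.mem_support_iff_exists_getVert.mp hi
      rw [SimpleGraph.Walk.drop_getVert] at hn
      rw [SimpleGraph.Walk.drop_length] at hle
      have := hinj (3 + n) i (by omega) (by omega) h1 (by omega) hn
      omega
    · exact hWq i h1 (by omega) hi
  refine ⟨q.getVert 1, q.getVert 2, q.getVert 3,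
    (q.adj_getVert_succ (i := 1) (by omega)).symm, q.adj_getVert_succ (i := 2) (by omega), ?_,
    ⟨.cons h01.symm W, hne 2 le_rfl (by omega), hne 3 (by omega) (by omega)⟩,
    ⟨(q.drop 3).append W, hdrop 2 (by omega) (by omega), hdrop 1 le_rfl (by omega)⟩⟩
  intro h
  have := hinj 1 3 le_rfl (by omega) (by omega) (by omega) h
  omega

/-- Every simple cycle has length at most three. -/
def CyclesAtMostThree (G : SimpleGraph V) : Prop :=
  ∀ (v : V) (c : G.Walk v v), c.IsCycle → c.length ≤ 3

/-- If all cycles are triangles, the neighbours `a ≠ b` of the ends of an edge `s(x, y)` are not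
joined by a walk avoiding that edge's ends. -/
lemma CyclesAtMostThree.false_of_walk (hC : CyclesAtMostThree G) {x y a b : V} (hxy : G.Adj x y)
    (hxa : G.Adj x a) (hyb : G.Adj y b) (hab : a ≠ b) (W : G.Walk a b) (hx : x ∉ W.support)
    (hy : y ∉ W.support) : False := by
  have hx' : x ∉ W.bypass.support := fun h => hx (W.support_bypass_subset_support h)
  have hy' : y ∉ W.bypass.support := fun h => hy (W.support_bypass_subset_support h)
  have hP := W.bypass_isPath
  have hlen : 1 ≤ W.bypass.length := by
    by_contra h
    exact hab (SimpleGraph.Walk.eq_of_length_eq_zero (p := W.bypass) (by omega))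
  have hQ : (W.bypass.concat hyb.symm).IsPath := hP.concat hy' hyb.symm
  have hxQ : x ∉ (W.bypass.concat hyb.symm).support := by
    simp [SimpleGraph.Walk.support_concat, hx', hxy.ne]
  have hcyc := (SimpleGraph.Walk.cons_isCycle_iff (SimpleGraph.Walk.cons hxa
      (W.bypass.concat hyb.symm)) hxy.symm).mpr ⟨hQ.cons hxQ, fun h => ?_⟩
  · have := hC _ _ hcyc
    simp only [SimpleGraph.Walk.length_cons, SimpleGraph.Walk.length_concat] at this
    omega
  · rw [SimpleGraph.Walk.edges_cons, List.mem_cons] at h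
    rcases h with h | h
    · rw [Sym2.eq_swap (a := y)] at h
      have hya : y = a := Sym2.congr_right.mp h
      exact hy (hya ▸ W.start_mem_support)
    · exact hxQ (SimpleGraph.Walk.snd_mem_support_of_mem_edges _ h)

lemma CyclesAtMostThree.eq_of_dist_lt (hC : CyclesAtMostThree G) (hG : G.Connected) {x y a b : V}
    (hxy : G.Adj x y) (hd : G.dist x t ≤ G.dist y t) (hxa : G.Adj x a)
    (ha : G.dist a t < G.dist x t) (hyb : G.Adj y b) (hbx : b ≠ x)
    (hb : G.dist b t ≤ G.dist x t) : a = b := by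
  by_contra hab
  obtain ⟨A, hA⟩ := exists_walk_dist_lt hG t a
  obtain ⟨B, hB⟩ := exists_walk_dist_lt hG t b
  have hA' : ∀ u ∈ A.support, G.dist u t < G.dist x t := by
    intro u hu
    rcases hA u hu with rfl | h <;> omega
  refine hC.false_of_walk hxy hxa hyb hab (A.append B.reverse) ?_ ?_ <;>
  · intro h
    rw [SimpleGraph.Walk.mem_support_append_iff, SimpleGraph.Walk.support_reverse,
      List.mem_reverse] at h
    rcases h with h | h
    · have := hA' _ h
      omega
    · rcases hB _ h with h | h
      · first
        | exact hbx h.symm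
        | exact hyb.ne h
      · omega

/-- `p` maps every vertex other than `t` to a neighbour closer to `t`, and fixes `t`. -/
structure IsParentMap (G : SimpleGraph V) (t : V) (p : V → V) : Prop where
  map_target : p t = t
  adj : ∀ {v}, v ≠ t → G.Adj v (p v)
  dist_add_one : ∀ {v}, v ≠ t → G.dist (p v) t + 1 = G.dist v t

lemma exists_isParentMap (hG : G.Connected) (t : V) : ∃ p, IsParentMap G t p := by
  choose f hf using fun v : {v : V // v ≠ t} => exists_adj_dist_add_one hG v.2
  refine ⟨fun v => if h : v ≠ t then f ⟨v, h⟩ else t, by simp, fun {v} hv => ?_, fun {v} hv => ?_⟩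
  · simpa [hv] using (hf ⟨v, hv⟩).1
  · simpa [hv] using (hf ⟨v, hv⟩).2

variable {p : V → V}

lemma IsParentMap.adj_cases (hp : IsParentMap G t p) (hC : CyclesAtMostThree G)
    (hG : G.Connected) {x y : V} (hxy : G.Adj x y) :
    p x = y ∨ p y = x ∨ (x ≠ t ∧ y ≠ t ∧ p x = p y) := by
  wlog hd : G.dist x t ≤ G.dist y t generalizing x y
  · rcases this hxy.symm (by omega) with h | h | ⟨h1, h2, h3⟩
    exacts [Or.inr (Or.inl h), Or.inl h, Or.inr (Or.inr ⟨h2, h1, h3.symm⟩)]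
  by_cases hyx : p y = x
  · exact Or.inr (Or.inl hyx)
  have htri := hG.dist_triangle (u := y) (v := x) (w := t)
  rw [SimpleGraph.dist_eq_one_iff_adj.mpr hxy.symm] at htri
  have hy : y ≠ t := by
    rintro rfl
    rw [SimpleGraph.dist_self, Nat.le_zero, hG.dist_eq_zero_iff] at hd
    exact hxy.ne hd
  have hdy := hp.dist_add_one hy
  have hx : x ≠ t := by
    rintro rfl
    rw [SimpleGraph.dist_self] at htri
    exact hyx (hG.dist_eq_zero_iff.mp (by omega))
  have hdx := hp.dist_add_one hx
  exact Or.inr (Or.inr ⟨hx, hy, hC.eq_of_dist_lt hG hxy hd (hp.adj hx) (by omega)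
    (hp.adj hy) hyx (by omega)⟩)

lemma IsParentMap.sibling_unique (hp : IsParentMap G t p) (hC : CyclesAtMostThree G)
    {x y z : V} (hx : x ≠ t) (hy : y ≠ t) (hz : z ≠ t) (hxy : G.Adj x y) (hxz : G.Adj x z)
    (hpy : p x = p y) (hpz : p x = p z) : y = z := by
  by_contra hyz
  have hzp : G.Adj z (p y) := by
    rw [← hpy, hpz]
    exact hp.adj hz
  refine hC.false_of_walk hxy hxz (hp.adj hy) hzp.ne hzp.toWalk ?_ ?_
  · simp [hxz.ne, hpy ▸ (hp.adj hx).ne]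
  · simp [hyz, (hp.adj hy).ne]

/-- A vertex still connected to `t` keeps its parent link, or has an active link to a sibling
that keeps its parent link. -/
lemma IsParentMap.active_parent_or_sibling (hp : IsParentMap G t p) (hC : CyclesAtMostThree G)
    (hG : G.Connected) {v : V} (hv : v ≠ t) (hvt : (G.deleteEdges F).Reachable v t) :
    s(v, p v) ∉ F ∨
      ∃ u, G.Adj v u ∧ s(v, u) ∉ F ∧ u ≠ t ∧ p v = p u ∧ s(u, p u) ∉ F := by
  by_contra! hcon
  obtain ⟨hvF, hsib⟩ := hcon
  let R : V → Prop := fun x => x = v ∨ (G.Adj v x ∧ s(v, x) ∉ F ∧ x ≠ t ∧ p v = p x)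
  have hRF : ∀ x, R x → s(x, p x) ∈ F := by
    rintro x (rfl | ⟨h1, h2, h3, h4⟩)
    exacts [hvF, hsib x h1 h2 h3 h4]
  have hRt : ¬ R t := by
    rintro (h | h)
    exacts [hv h.symm, h.2.2.1 rfl]
  have hstep : ∀ x y, (G.deleteEdges F).Adj x y → (∃ n, R (p^[n] x)) → ∃ n, R (p^[n] y) := by
    rintro x y hxy ⟨n, hn⟩
    rw [SimpleGraph.deleteEdges_adj] at hxy
    obtain ⟨hxy, hF⟩ := hxy
    rcases hp.adj_cases hC hG hxy with h | h | ⟨hx, hy, h⟩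
    · cases n with
      | zero => exact absurd (h ▸ hRF x hn) hF
      | succ n => exact ⟨n, by rwa [Function.iterate_succ_apply, h] at hn⟩
    · exact ⟨n + 1, by rwa [Function.iterate_succ_apply, h]⟩
    · cases n with
      | zero =>
        refine ⟨0, ?_⟩
        rcases hn with rfl | ⟨h1, h2, h3, h4⟩
        · exact Or.inr ⟨hxy, hF, hy, h⟩
        · exact Or.inl (hp.sibling_unique hC hx hy hv hxy h1.symm h h4.symm)
      | succ n =>
        exact ⟨n + 1, by rwa [Function.iterate_succ_apply, h, ← Function.iterate_succ_apply] at hn⟩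
  have hwalk : ∀ x, (G.deleteEdges F).Walk x t → ¬ ∃ n, R (p^[n] x) := by
    intro x W
    induction W with
    | nil =>
      rintro ⟨n, hn⟩
      rw [Function.iterate_fixed hp.map_target] at hn
      exact hRt hn
    | cons h _ ih => exact fun hx => ih hp hv hvt hsib hRF hRt hstep (hstep _ _ h hx)
  obtain ⟨W⟩ := hvt
  exact hwalk v W ⟨0, Or.inl rfl⟩

/-- The neighbours of `v` along active links. -/
def activeNeighbors (G : SimpleGraph V) (F : Set (Sym2 V)) (v : V) : Set V :=
  {w | G.Adj v w ∧ s(v, w) ∉ F}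

lemma activeNeighbors_congr {F' : Set (Sym2 V)} {v : V}
    (h : F ∩ G.incidenceSet v = F' ∩ G.incidenceSet v) :
    activeNeighbors G F v = activeNeighbors G F' v := by
  ext w
  refine and_congr_right fun hw => not_congr ?_
  have hmem : s(v, w) ∈ G.incidenceSet v := ⟨hw, Sym2.mem_mk_left v w⟩
  have := Set.ext_iff.mp h s(v, w)
  simpa [hmem] using this

/-- An element of `S` closest to `t`, or `v` if `S` is empty. -/
noncomputable def closest (G : SimpleGraph V) (t v : V) (S : Set V) : V :=
  if h : S.Nonempty then Function.argminOn (fun w => G.dist w t) S h else v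

lemma closest_mem {S : Set V} (v : V) (h : S.Nonempty) : closest G t v S ∈ S := by
  rw [closest, dif_pos h]
  exact Function.argminOn_mem _ _ _

lemma dist_closest_le {S : Set V} (v : V) {w : V} (hw : w ∈ S) :
    G.dist (closest G t v S) t ≤ G.dist w t := by
  rw [closest, dif_pos ⟨w, hw⟩]
  exact Function.argminOn_le (fun w => G.dist w t) S hw

/-- Forward to an active neighbour closest to `t`. -/
noncomputable def greedyFwd (G : SimpleGraph V) (t : V) : Fwd V :=
  fun F v _ => s(v, closest G t v (activeNeighbors G F v))

lemma nextHop_greedyFwd (v : V) :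
    nextHop (greedyFwd G t) F v = closest G t v (activeNeighbors G F v) :=
  step_mk _ _

lemma isFwdPattern_greedyFwd : IsFwdPattern G (greedyFwd G t) := by
  intro F hF v e
  rw [greedyFwd]
  by_cases h : (activeNeighbors G F v).Nonempty
  · have hmem := closest_mem (G := G) (t := t) v h
    exact ⟨Or.inl ⟨hmem.1, Sym2.mem_mk_left _ _⟩, fun _ => hmem.2⟩
  · rw [closest, dif_neg h]
    exact ⟨Or.inr rfl, fun _ hmem => G.loopless.irrefl v (hF hmem)⟩

lemma isLocal_greedyFwd : IsLocal G (greedyFwd G t) := by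
  intro F _ F' _ v h e
  rw [greedyFwd, greedyFwd, activeNeighbors_congr h]

lemma inPortOblivious_greedyFwd : InPortOblivious G (greedyFwd G t) :=
  fun _ _ _ _ _ => rfl

lemma reachable_nextHop_greedyFwd {v : V} (h : (G.deleteEdges F).Reachable v t) :
    (G.deleteEdges F).Reachable (nextHop (greedyFwd G t) F v) t := by
  rw [nextHop_greedyFwd]
  by_cases hS : (activeNeighbors G F v).Nonempty
  · have hadj : (G.deleteEdges F).Adj v (closest G t v (activeNeighbors G F v)) := by
      rw [SimpleGraph.deleteEdges_adj]
      exact closest_mem v hS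
    exact hadj.symm.reachable.trans h
  · rwa [closest, dif_neg hS]

lemma dist_greedyFwd_lt (hC : CyclesAtMostThree G) (hG : G.Connected) {v : V} (hv : v ≠ t)
    (hvt : (G.deleteEdges F).Reachable v t) :
    ∃ n, G.dist ((nextHop (greedyFwd G t) F)^[n] v) t < G.dist v t := by
  obtain ⟨p, hp⟩ := exists_isParentMap hG t
  have hparent : ∀ {u}, u ≠ t → s(u, p u) ∉ F →
      G.dist (nextHop (greedyFwd G t) F u) t < G.dist u t := by
    intro u hu hF
    rw [nextHop_greedyFwd]
    have h1 := dist_closest_le (G := G) (t := t) u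
      (show p u ∈ activeNeighbors G F u from ⟨hp.adj hu, hF⟩)
    have h2 := hp.dist_add_one hu
    omega
  by_cases hvF : s(v, p v) ∉ F
  · exact ⟨1, hparent hv hvF⟩
  obtain ⟨u, hvu, hvuF, hu, hpu, huF⟩ :=
    (hp.active_parent_or_sibling hC hG hv hvt).resolve_left hvF
  have hmem : u ∈ activeNeighbors G F v := ⟨hvu, hvuF⟩
  have hdv := hp.dist_add_one hv
  have hdu := hp.dist_add_one hu
  rw [← hpu] at hdu
  have hnext : nextHop (greedyFwd G t) F v = u := by
    rw [nextHop_greedyFwd]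
    have hle := dist_closest_le (G := G) (t := t) v hmem
    have hcl := closest_mem (G := G) (t := t) v ⟨u, hmem⟩
    generalize closest G t v (activeNeighbors G F v) = w at hle hcl
    obtain ⟨hvw, hwF⟩ := hcl
    rcases hp.adj_cases hC hG hvw with h | h | ⟨_, hw, h⟩
    · exact absurd (h ▸ hwF) hvF
    · have hw : w ≠ t := by
        rintro rfl
        exact hvw.ne (h.symm.trans hp.map_target)
      have := hp.dist_add_one hw
      rw [h] at this
      omega
    · exact hp.sibling_unique hC hv hw hu hvw hvu h hpu
  refine ⟨2, ?_⟩
  have := hparent hu huF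
  rw [Function.iterate_succ_apply, Function.iterate_one, hnext]
  omega

lemma perfectlyResilient_greedyFwd (hC : CyclesAtMostThree G) (hG : G.Connected) :
    PerfectlyResilient G (greedyFwd G t) t := by
  intro F hF v hvt
  rw [reaches_iff_exists_iterate (inPortOblivious_greedyFwd F hF)]
  induction h : G.dist v t using Nat.strong_induction_on generalizing v with
  | _ d ih =>
    by_cases hv : v = t
    · exact ⟨0, hv⟩
    obtain ⟨n, hn⟩ := dist_greedyFwd_lt hC hG hv hvt
    have hreach : ∀ k, (G.deleteEdges F).Reachable ((nextHop (greedyFwd G t) F)^[k] v) t := by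
      intro k
      induction k with
      | zero => exact hvt
      | succ k ihk =>
        rw [Function.iterate_succ_apply']
        exact reachable_nextHop_greedyFwd ihk
    obtain ⟨m, hm⟩ := ih _ (h ▸ hn) _ (hreach n) rfl
    exact ⟨m + n, by rw [Function.iterate_add_apply, hm]⟩

end FRR

open FRR in
/-- For a finite connected simple graph `G` with target `t`, there exists an
in-port oblivious local forwarding pattern that is perfectly resilient for `t`
if and only if every simple cycle of `G` has length at most `3`. -/
theorem exists_inport_oblivious_perfectly_resilient_iff {V : Type*} [Fintype V]
    (G : SimpleGraph V) (hG : G.Connected) (t : V) :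
    (∃ ρ : Fwd V, IsFwdPattern G ρ ∧ IsLocal G ρ ∧ InPortOblivious G ρ ∧
        PerfectlyResilient G ρ t) ↔
      ∀ (v : V) (c : G.Walk v v), c.IsCycle → c.length ≤ 3 := by
  constructor
  · rintro ⟨ρ, hpat, hloc, hobl, hres⟩ v c hc
    by_contra hlen
    obtain ⟨a, b, c, hba, hbc, hac, ⟨W, hbW, hcW⟩, W', hbW', haW'⟩ :=
      exists_walks_of_isCycle hG t hc (by omega)
    exact not_perfectlyResilient_of_walks hpat hloc hobl hba hbc hac W hbW hcW W' hbW' haW' hres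
  · intro hC
    exact ⟨greedyFwd G t, isFwdPattern_greedyFwd, isLocal_greedyFwd, inPortOblivious_greedyFwd,
      perfectlyResilient_greedyFwd hC hG⟩
end

section
/- Let G = (V, E) be a finite connected simple graph that contains a simple cycle of length at least 4, and let t ∈ V be any vertex. Then there exist three pairwise distinct vertices s, u, v, all different from t, such that {s,u} ∈ E and {s,v} ∈ E, there is a path in G from u to t containing neither s nor v, and there is a path in G from v to t containing neither s nor u. -/
/-- A walk that meets a set `S` contains a final segment which meets `S` only at its start. -/
theorem SimpleGraph.Walk.exists_walk_meets_only_at_start {V : Type*} {G : SimpleGraph V}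
    {x t : V} (S : Set V) (p : G.Walk x t) (hp : ∃ y ∈ p.support, y ∈ S) :
    ∃ a ∈ S, ∃ q : G.Walk a t, ∀ y ∈ q.support, y ∈ S → y = a := by
  induction p with
  | nil =>
    obtain ⟨y, hy, hyS⟩ := hp
    rw [SimpleGraph.Walk.mem_support_nil_iff] at hy
    subst hy
    exact ⟨y, hyS, .nil, by simp⟩
  | @cons x z t h p ih =>
    by_cases hz : ∃ y ∈ p.support, y ∈ S
    · exact ih hz
    · obtain ⟨y, hy, hyS⟩ := hp
      rw [SimpleGraph.Walk.support_cons, List.mem_cons] at hy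
      rcases hy with rfl | hy
      · refine ⟨y, hyS, .cons h p, fun w hw hwS => ?_⟩
        rw [SimpleGraph.Walk.support_cons, List.mem_cons] at hw
        exact hw.resolve_right fun hw => hz ⟨w, hw, hwS⟩
      · exact absurd ⟨y, hy, hyS⟩ hz

/-- A walk avoiding two vertices can be shortened to a path avoiding them. -/
theorem SimpleGraph.Walk.exists_isPath_avoiding {V : Type*} {G : SimpleGraph V}
    {x t a b : V} (p : G.Walk x t) (ha : a ∉ p.support) (hb : b ∉ p.support) :
    ∃ p : G.Walk x t, p.IsPath ∧ a ∉ p.support ∧ b ∉ p.support := by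
  classical
  exact ⟨p.bypass, p.bypass_isPath, fun h => ha (p.support_bypass_subset_support h),
    fun h => hb (p.support_bypass_subset_support h)⟩


/-- If a finite connected simple graph `G` contains a simple cycle of length at
least `4`, then for every vertex `t` there are three pairwise distinct vertices
`s`, `u`, `v`, all different from `t`, such that `s` is adjacent to both `u` and
`v`, there is a path from `u` to `t` containing neither `s` nor `v`, and there is
a path from `v` to `t` containing neither `s` nor `u`. -/
theorem exists_fork_of_long_cycle {V : Type*} [Fintype V]
    (G : SimpleGraph V) (hG : G.Connected)
    (hcyc : ∃ (w : V) (c : G.Walk w w), c.IsCycle ∧ 4 ≤ c.length) (t : V) :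
    ∃ s u v : V, s ≠ u ∧ s ≠ v ∧ u ≠ v ∧ s ≠ t ∧ u ≠ t ∧ v ≠ t ∧
      G.Adj s u ∧ G.Adj s v ∧
      (∃ p : G.Walk u t, p.IsPath ∧ s ∉ p.support ∧ v ∉ p.support) ∧
      (∃ p : G.Walk v t, p.IsPath ∧ s ∉ p.support ∧ u ∉ p.support) := by
  classical
  obtain ⟨w, c, hc, hlen⟩ := hcyc
  obtain ⟨p⟩ := hG.preconnected w t
  obtain ⟨a, ha, q, hq⟩ := p.exists_walk_meets_only_at_start {y | y ∈ c.support}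
    ⟨w, p.start_mem_support, c.start_mem_support⟩
  have hq' : ∀ y ∈ q.support, y ∈ (c.rotate a ha).support → y = a := fun y hy hyc =>
    hq y hy ((c.mem_support_rotate_iff a ha).1 hyc)
  have hd := hc.rotate ha
  have hdlen : 4 ≤ (c.rotate a ha).length := by rwa [c.length_rotate]
  generalize c.rotate a ha = d at hq' hd hdlen
  have hnodup := hd.support_nodup
  match d, hq', hdlen, hnodup with
  | .cons (v := u) hau (.cons (v := s) hus (.cons (v := v) hsv r)), hq', hdlen, hnodup =>
    have hva : v ≠ a := by
      rintro rfl
      cases r with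
      | nil => simp at hdlen
      | cons h r => simp at hnodup
    simp only [SimpleGraph.Walk.support_cons, List.tail_cons, List.nodup_cons,
      List.mem_cons, not_or] at hq' hnodup
    obtain ⟨⟨hne, hur⟩, hsr, -⟩ := hnodup
    have huv : u ≠ v := fun h => hur (h ▸ r.start_mem_support)
    have hsq : s ∉ q.support := fun h => hsr (hq' s h (by simp) ▸ r.end_mem_support)
    have huq : u ∉ q.support := fun h => hur (hq' u h (by simp) ▸ r.end_mem_support)
    have hvq : v ∉ q.support := fun h => hva (hq' v h (by simp))
    have hne_t : ∀ {y}, y ∉ q.support → y ≠ t := fun h ht => h (ht ▸ q.end_mem_support)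
    refine ⟨s, u, v, Ne.symm hne, hsv.ne, huv, hne_t hsq, hne_t huq, hne_t hvq,
      hus.symm, hsv, ?_, ?_⟩
    · exact (SimpleGraph.Walk.cons hau.symm q).exists_isPath_avoiding
        (by simp [hsq, Ne.symm hne]) (by simp [hvq, Ne.symm huv])
    · exact (r.append q).exists_isPath_avoiding
        (by simp [SimpleGraph.Walk.mem_support_append_iff, hsr, hsq])
        (by simp [SimpleGraph.Walk.mem_support_append_iff, hur, huq])
end

section
/- Let G = (V, E) be a finite connected simple graph with target vertex t, and suppose there exist three pairwise distinct vertices s, u, v, all different from t, such that {s,u} ∈ E and {s,v} ∈ E, there is a path from u to t containing neither s nor v, and there is a path from v to t containing neither s nor u. Then no in-port oblivious local forwarding pattern is perfectly resilient for t. -/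
open Classical

namespace FRR

theorem step_mk_left (a b : V) : step a s(a, b) = b := by
  have h : a ∈ s(a, b) := Sym2.mem_mk_left a b
  rw [step, dif_pos h]
  exact Sym2.congr_right.mp (Sym2.other_spec h)

/-- A routing never leaves a set of vertices that is closed under forwarding. -/
theorem not_reaches_of_closed {ρ : Fwd V} {F : Set (Sym2 V)} {S : Set V} {s t : V}
    (hs : s ∈ S) (ht : t ∉ S) (hS : ∀ x ∈ S, ∀ e, step x (ρ F x e) ∈ S) :
    ¬ Reaches ρ F s t := by
  have key : ∀ n, (route ρ F s n).1 ∈ S ∧ (route ρ F s n).2 ∈ S := by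
    intro n
    induction n with
    | zero => exact ⟨hs, hs⟩
    | succ n ih => exact ⟨ih.2, hS _ ih.2 _⟩
  rintro ⟨n, hn⟩
  exact ht (hn ▸ (key n).1)

/-- A forwarding pattern sends a packet to the vertex itself or over an active link. -/
theorem IsFwdPattern.eq_loop_or_active {G : SimpleGraph V} {ρ : Fwd V} (hρ : IsFwdPattern G ρ)
    {F : Set (Sym2 V)} (hF : F ⊆ G.edgeSet) {x y : V} (hxy : G.Adj x y) (hy : s(x, y) ∉ F)
    (e : Sym2 V) :
    ρ F x e = s(x, x) ∨ ρ F x e ∈ G.incidenceSet x \ F := by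
  obtain ⟨h₁, h₂⟩ := hρ F hF x e
  have hact : ρ F x e ∉ F := h₂ fun h => hy (h ⟨hxy, Sym2.mem_mk_left x y⟩)
  rcases h₁ with h | h
  · exact .inr ⟨h, hact⟩
  · exact .inl h

/-- The failure scenario in which only the links `s(s, u)`, `s(s, v)` and those of `p` survive. -/
def forkFailures (G : SimpleGraph V) (s u v : V) {a b : V} (p : G.Walk a b) : Set (Sym2 V) :=
  G.edgeSet \ ({s(s, u), s(s, v)} ∪ {e | e ∈ p.edges})

theorem forkFailures_inter_incidenceSet {G : SimpleGraph V} {s a b : V} (u v : V)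
    {p : G.Walk a b} (hs : s ∉ p.support) :
    forkFailures G s u v p ∩ G.incidenceSet s = G.incidenceSet s \ {s(s, u), s(s, v)} := by
  ext e
  have hp : e ∈ p.edges → s ∉ e := fun he hse =>
    hs (p.mem_support_of_mem_edges he hse)
  simp only [forkFailures, SimpleGraph.incidenceSet, Set.mem_inter_iff, Set.mem_sdiff,
    Set.mem_union, Set.mem_ofPred_eq]
  tauto

/-- In the scenario `forkFailures G s u v p` with `p` leading from `v` to `t`, a perfectly
resilient in-port oblivious pattern forwards from `s` to `v`, since `u` has to bounce back. -/
theorem fwd_forkFailures_eq {G : SimpleGraph V} {ρ : Fwd V} {s t u v : V}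
    (hst : s ≠ t) (hut : u ≠ t) (hsu : G.Adj s u) (hsv : G.Adj s v) (huv : u ≠ v)
    (p : G.Walk v t) (hs : s ∉ p.support) (hu : u ∉ p.support)
    (hρ : IsFwdPattern G ρ) (hobl : InPortOblivious G ρ) (hres : PerfectlyResilient G ρ t)
    (e : Sym2 V) :
    ρ (forkFailures G s u v p) s e = s(s, v) := by
  set F := forkFailures G s u v p with hFdef
  have hF : F ⊆ G.edgeSet := Set.sdiff_subset
  have hsuF : s(s, u) ∉ F := by simp [hFdef, forkFailures]
  have hsvF : s(s, v) ∉ F := by simp [hFdef, forkFailures]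
  have hconn : (G.deleteEdges F).Reachable s t := by
    have h₁ : (G.deleteEdges F).Adj s v := by
      rw [SimpleGraph.deleteEdges_adj]
      exact ⟨hsv, hsvF⟩
    have h₂ : (G.deleteEdges F).Reachable v t :=
      ⟨p.toDeleteEdges F fun e he heF => heF.2 (.inr he)⟩
    exact h₁.reachable.trans h₂
  by_contra hne
  refine not_reaches_of_closed (S := {s, u}) (by simp) (by simp [hst.symm, hut.symm]) ?_
    (hres F hF s hconn)
  have active : ∀ {f : Sym2 V} {x : V}, f ∈ G.incidenceSet x \ F → x ∉ p.support →
      f = s(s, u) ∨ f = s(s, v) := by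
    intro f x hf hx
    by_contra hcon
    refine hf.2 ⟨hf.1.1, ?_⟩
    rintro (h | h)
    · exact hcon h
    · exact hx (p.mem_support_of_mem_edges h hf.1.2)
  rintro x (rfl | rfl) e'
  · rcases hρ.eq_loop_or_active hF hsu hsuF e' with h | h
    · simp [h, step_mk_left]
    · rcases active h hs with h' | h'
      · simp [h', step_mk_left]
      · exact absurd (hobl F hF _ e e' ▸ h') hne
  · rcases hρ.eq_loop_or_active hF hsu.symm (Sym2.eq_swap ▸ hsuF) e' with h | h
    · simp [h, step_mk_left]
    · rcases active h hu with h' | h'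
      · simp [h', Sym2.eq_swap (a := s), step_mk_left]
      · have hx := h.1.2
        rw [h', Sym2.mem_iff] at hx
        exact (hx.elim hsu.ne.symm huv).elim

end FRR

open FRR in
/-- If a finite connected simple graph `G` with target `t` contains three pairwise
distinct vertices `s`, `u`, `v`, all different from `t`, such that `s` is adjacent
to both `u` and `v`, there is a path from `u` to `t` containing neither `s` nor
`v`, and there is a path from `v` to `t` containing neither `s` nor `u`, then no
in-port oblivious local forwarding pattern is perfectly resilient for `t`. -/
theorem no_inport_oblivious_perfectly_resilient_of_fork {V : Type*} [Fintype V]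
    (G : SimpleGraph V) (hG : G.Connected) (t s u v : V)
    (hsu : s ≠ u) (hsv : s ≠ v) (huv : u ≠ v)
    (hst : s ≠ t) (hut : u ≠ t) (hvt : v ≠ t)
    (hadj₁ : G.Adj s u) (hadj₂ : G.Adj s v)
    (hpu : ∃ p : G.Walk u t, p.IsPath ∧ s ∉ p.support ∧ v ∉ p.support)
    (hpv : ∃ p : G.Walk v t, p.IsPath ∧ s ∉ p.support ∧ u ∉ p.support) :
    ∀ ρ : Fwd V, IsFwdPattern G ρ → IsLocal G ρ → InPortOblivious G ρ →
      ¬ PerfectlyResilient G ρ t := by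
  intro ρ hρ hloc hobl hres
  obtain ⟨p, -, hsp, hvp⟩ := hpu
  obtain ⟨q, -, hsq, huq⟩ := hpv
  have hv := fwd_forkFailures_eq hst hut hadj₁ hadj₂ huv q hsq huq hρ hobl hres s(s, s)
  have hu := fwd_forkFailures_eq hst hvt hadj₂ hadj₁ huv.symm p hsp hvp hρ hobl hres s(s, s)
  have hlocal := hloc (forkFailures G s u v q) Set.sdiff_subset (forkFailures G s v u p)
    Set.sdiff_subset s
    (by rw [forkFailures_inter_incidenceSet u v hsq, forkFailures_inter_incidenceSet v u hsp,
      Set.pair_comm]) s(s, s)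
  rw [hv, hu] at hlocal
  exact huv (Sym2.congr_right.mp hlocal).symm
end

section
/- Let G be a finite connected simple graph in which every simple cycle has length at most 3. Then for every pair of vertices u and t there is exactly one path from u to t whose length equals the graph distance between u and t; that is, shortest paths in G are unique. -/
/-- In a finite connected simple graph in which every simple cycle has length at
most `3`, shortest paths are unique: for every pair of vertices `u` and `t` there
is exactly one path from `u` to `t` whose length equals the graph distance. -/
theorem unique_shortest_path_of_cycles_le_three {V : Type*} [Fintype V]
    (G : SimpleGraph V) (hG : G.Connected)
    (hcyc : ∀ (w : V) (c : G.Walk w w), c.IsCycle → c.length ≤ 3) (u t : V) :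
    ∃! p : G.Walk u t, p.IsPath ∧ p.length = G.dist u t := by
  obtain ⟨p, hp, hpl⟩ := hG.exists_path_of_dist u t
  refine ⟨p, ⟨hp, hpl⟩, fun q ⟨hq, hql⟩ ↦ ?_⟩
  by_contra hne
  obtain ⟨u', v', p', q', hp', hq', hc⟩ := hq.exists_isCycle_of_ne hp hne
  have hpd := SimpleGraph.length_eq_dist_of_subwalk hql hp'
  have hqd := SimpleGraph.length_eq_dist_of_subwalk hpl hq'
  have hle := hcyc _ _ hc
  have hge := hc.three_le_length
  rw [SimpleGraph.Walk.length_append, SimpleGraph.Walk.length_reverse] at hle hge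
  omega
end

section
/- Let G be a finite connected simple graph in which every simple cycle has length at most 3, let t be a vertex of G, and let a, b, c be three pairwise adjacent vertices (a triangle) with t ∉ {a, b, c}. Then there is exactly one vertex u ∈ {a, b, c} such that G contains a path from u to t avoiding the other two vertices of the triangle; moreover, for this vertex u, every path from either of the other two triangle vertices to t passes through u. -/
namespace SimpleGraph

variable {V : Type*} {G : SimpleGraph V}

/-- A path meeting `S` has a final segment that meets `S` only in its first vertex. -/
theorem Walk.IsPath.exists_suffix_meeting_once {S : Set V} {w t : V} {p : G.Walk w t}
    (hp : p.IsPath) (h : ∃ s ∈ S, s ∈ p.support) :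
    ∃ u ∈ S, ∃ q : G.Walk u t, q.IsPath ∧ q.support ⊆ p.support ∧
      ∀ s ∈ S, s ≠ u → s ∉ q.support := by
  induction p with
  | nil =>
    obtain ⟨s, hs, hsp⟩ := h
    obtain rfl : s = _ := by simpa using hsp
    exact ⟨s, hs, .nil, .nil, List.Subset.refl _, by simp⟩
  | cons hadj p ih =>
    by_cases hS : ∃ s ∈ S, s ∈ p.support
    · obtain ⟨u, hu, q, hq, hsub, havoid⟩ := ih hp.of_cons hS
      exact ⟨u, hu, q, hq, List.Subset.trans hsub (by simp), havoid⟩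
    · push Not at hS
      obtain ⟨s, hs, hsp⟩ := h
      rw [Walk.support_cons, List.mem_cons] at hsp
      obtain rfl := hsp.resolve_right (hS s hs)
      exact ⟨s, hs, .cons hadj p, hp, List.Subset.refl _, fun r hr hne => by
        simp [hne, hS r hr]⟩

/-- If all cycles have length at most three, then a path between two vertices of a triangle that
avoids the third vertex is a single edge. -/
theorem Walk.IsPath.mem_edges_of_cycles_le_three
    (hcyc : ∀ (w : V) (cw : G.Walk w w), cw.IsCycle → cw.length ≤ 3)
    {x y z : V} (hxy : x ≠ y) (hyz : G.Adj y z) (hzx : G.Adj z x) {p : G.Walk x y}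
    (hp : p.IsPath) (hz : z ∉ p.support) : s(x, y) ∈ p.edges := by
  have hcycle : (Walk.cons hzx (p.concat hyz)).IsCycle := by
    rw [Walk.cons_isCycle_iff]
    refine ⟨hp.concat hz hyz, fun h => ?_⟩
    rw [Walk.edges_concat, List.concat_eq_append, List.mem_append] at h
    rcases h with h | h
    · exact hz (p.fst_mem_support_of_mem_edges h)
    · simp_all
  have hlen := hcyc _ _ hcycle
  rw [Walk.length_cons, Walk.length_concat] at hlen
  cases p with
  | nil => exact absurd rfl hxy
  | cons h p =>
    cases p with
    | nil => simp
    | cons h' p => grind [Walk.length_cons]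

/-- If all cycles have length at most three, then a vertex is reachable by walks that leave a
triangle immediately from at most one vertex of the triangle. -/
theorem eq_of_walks_avoiding_triangle
    (hcyc : ∀ (w : V) (cw : G.Walk w w), cw.IsCycle → cw.length ≤ 3)
    {S : Set V} (hS : G.IsClique S) {x y z t : V} (hx : x ∈ S) (hy : y ∈ S) (hz : z ∈ S)
    (hzx : z ≠ x) (hzy : z ≠ y) (p : G.Walk x t) (hp : ∀ s ∈ S, s ≠ x → s ∉ p.support)
    (q : G.Walk y t) (hq : ∀ s ∈ S, s ≠ y → s ∉ q.support) : x = y := by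
  classical
  by_contra hxy
  have hz' : z ∉ (p.append q.reverse).support := by
    simp [Walk.mem_support_append_iff, hp z hz hzx, hq z hz hzy]
  have hmem := (Walk.bypass_isPath (p.append q.reverse)).mem_edges_of_cycles_le_three hcyc hxy
    (hS hy hz hzy.symm) (hS hz hx hzx) (fun h => hz' (Walk.support_bypass_subset_support _ h))
  have hmem' := Walk.edges_bypass_subset_edges _ hmem
  rw [Walk.edges_append, Walk.edges_reverse, List.mem_append, List.mem_reverse] at hmem'
  rcases hmem' with h | h
  · exact hp y hy (Ne.symm hxy) (p.snd_mem_support_of_mem_edges h)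
  · exact hq x hx hxy (q.fst_mem_support_of_mem_edges h)

end SimpleGraph

/-- Let `G` be a finite connected simple graph in which every simple cycle has
length at most `3`, let `t` be a vertex and let `a`, `b`, `c` form a triangle not
containing `t`.  Then there is exactly one vertex `u` of the triangle from which
there is a path to `t` avoiding the other two triangle vertices; moreover, every
path from either of the other two triangle vertices to `t` passes through `u`. -/
theorem triangle_unique_exit_of_cycles_le_three {V : Type*} [Fintype V]
    (G : SimpleGraph V) (hG : G.Connected)
    (hcyc : ∀ (w : V) (cw : G.Walk w w), cw.IsCycle → cw.length ≤ 3)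
    (t a b c : V) (hab : G.Adj a b) (hbc : G.Adj b c) (hca : G.Adj c a)
    (hta : t ≠ a) (htb : t ≠ b) (htc : t ≠ c) :
    ∃ u ∈ ({a, b, c} : Set V),
      (∃ p : G.Walk u t, p.IsPath ∧ ∀ w ∈ ({a, b, c} : Set V), w ≠ u → w ∉ p.support) ∧
      (∀ u' ∈ ({a, b, c} : Set V),
        (∃ p : G.Walk u' t, p.IsPath ∧ ∀ w ∈ ({a, b, c} : Set V), w ≠ u' → w ∉ p.support) →
        u' = u) ∧
      (∀ w ∈ ({a, b, c} : Set V), w ≠ u →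
        ∀ p : G.Walk w t, p.IsPath → u ∈ p.support) := by
  have hS : G.IsClique ({a, b, c} : Set V) := by
    simp [SimpleGraph.isClique_insert, hab, hbc, hca.symm]
  have hunique : ∀ x ∈ ({a, b, c} : Set V), ∀ y ∈ ({a, b, c} : Set V),
      ∀ p : G.Walk x t, (∀ s ∈ ({a, b, c} : Set V), s ≠ x → s ∉ p.support) →
      ∀ q : G.Walk y t, (∀ s ∈ ({a, b, c} : Set V), s ≠ y → s ∉ q.support) → x = y := by
    intro x hx y hy p hp q hq
    obtain ⟨z, hz, hzx, hzy⟩ : ∃ z ∈ ({a, b, c} : Set V), z ≠ x ∧ z ≠ y := by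
      have := hab.ne
      have := hbc.ne
      have := hca.ne
      simp only [Set.mem_insert_iff, Set.mem_singleton_iff, exists_eq_or_imp, exists_eq_left]
        at hx hy ⊢
      grind
    exact SimpleGraph.eq_of_walks_avoiding_triangle hcyc hS hx hy hz hzx hzy p hp q hq
  obtain ⟨p, hp⟩ := (hG a t).exists_isPath
  obtain ⟨u, hu, q, hq, -, hqS⟩ :=
    hp.exists_suffix_meeting_once (S := {a, b, c}) ⟨a, by simp, p.start_mem_support⟩
  refine ⟨u, hu, ⟨q, hq, hqS⟩, ?_, ?_⟩
  · rintro u' hu' ⟨r, -, hr⟩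
    exact hunique u' hu' u hu r hr q hqS
  · intro w hw _ r hr
    obtain ⟨v, hv, r', -, hsub, hr'⟩ :=
      hr.exists_suffix_meeting_once ⟨w, hw, r.start_mem_support⟩
    obtain rfl := hunique v hv u hu r' hr' q hqS
    exact hsub r'.start_mem_support
end

section
/- Let G = (V, E) be a finite connected simple graph, t ∈ V, and let T be a spanning tree of G such that for every vertex v the distance from v to t in T equals the distance from v to t in G (a BFS tree rooted at t); for v ≠ t let parent(v) denote the neighbor of v in T on the unique T-path from v to t. Then every simple cycle of G has length at most 3 if and only if both of the following hold: (i) every edge of G not in T joins two vertices u and v with parent(u) = parent(v), and (ii) every vertex of G is incident to at most one edge of G not in T. -/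
namespace SimpleGraph

variable {V : Type*} {G T : SimpleGraph V} {t : V} {parent : V → V}

/-- In a tree, the neighbor of a vertex lying closer to a given root is unique. -/
lemma IsTree.eq_of_adj_of_dist_add_one_eq (hT : T.IsTree) {x y z : V}
    (hy : T.Adj x y) (hz : T.Adj x z)
    (hdy : T.dist y t + 1 = T.dist x t) (hdz : T.dist z t + 1 = T.dist x t) : y = z := by
  obtain ⟨p, hp⟩ := hT.connected.exists_walk_length_eq_dist y t
  obtain ⟨q, hq⟩ := hT.connected.exists_walk_length_eq_dist z t
  have hp' : (Walk.cons hy p).IsPath :=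
    Walk.isPath_of_length_eq_dist _ (by rw [Walk.length_cons, hp, hdy])
  have hq' : (Walk.cons hz q).IsPath :=
    Walk.isPath_of_length_eq_dist _ (by rw [Walk.length_cons, hq, hdz])
  have h := (hT.existsUnique_path x t).unique hp' hq'
  simpa using congrArg Walk.snd h

/-- An edge of `G` outside a spanning subgraph that preserves distances to `t` is not incident
to `t`. -/
lemma ne_root_of_adj_of_not_adj (hdist : ∀ v, T.dist v t = G.dist v t) {u v : V}
    (hG : G.Adj u v) (hT : ¬ T.Adj u v) : v ≠ t := by
  rintro rfl
  exact hT (dist_eq_one_iff_adj.1 ((hdist u).trans (dist_eq_one_iff_adj.2 hG)))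

/-- In a rooted tree, a neighbor of `x` that is not deeper than `x` is the parent of `x`. -/
lemma IsTree.eq_parent_of_adj_of_dist_le (hT : T.IsTree)
    (hparent : ∀ v, v ≠ t → T.Adj v (parent v) ∧ T.dist (parent v) t + 1 = T.dist v t)
    {x y : V} (h : T.Adj x y) (hle : T.dist y t ≤ T.dist x t) : y = parent x := by
  have hd : T.dist y t + 1 = T.dist x t := by
    have := hT.dist_eq_dist_add_one_of_adj t h
    rw [dist_comm (u := t), dist_comm (u := t)] at this
    lia
  have hx : x ≠ t := by
    rintro rfl
    simp at hd
  exact hT.eq_of_adj_of_dist_add_one_eq h (hparent x hx).1 hd (hparent x hx).2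

/-- If all cycles of `G` are triangles, then an edge outside a BFS tree joins siblings. -/
lemma parent_eq_of_cycles_length_le_three (hTG : T ≤ G) (hT : T.IsTree)
    (hdist : ∀ v, T.dist v t = G.dist v t)
    (hparent : ∀ v, v ≠ t → T.Adj v (parent v) ∧ T.dist (parent v) t + 1 = T.dist v t)
    (hc : ∀ (w : V) (c : G.Walk w w), c.IsCycle → c.length ≤ 3)
    {u v : V} (huv : G.Adj u v) (hnT : ¬ T.Adj u v) : parent u = parent v := by
  obtain ⟨p, hp, hpd⟩ := hT.connected.exists_path_of_dist u v
  have hcyc : (Walk.cons huv.symm (p.mapLe hTG)).IsCycle := by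
    rw [Walk.cons_isCycle_iff]
    refine ⟨(Walk.isPath_mapLe hTG).2 hp, fun he ↦ hnT ?_⟩
    rw [Walk.edges_mapLe_eq_edges] at he
    exact (p.adj_of_mem_edges he).symm
  have hlen := hc _ _ hcyc
  have h0 : p.length ≠ 0 := fun h ↦ huv.ne (Walk.eq_of_length_eq_zero h)
  have h1 : p.length ≠ 1 := fun h ↦ hnT (Walk.adj_of_length_eq_one h)
  have h2 : p.length = 2 := by
    simp at hlen
    lia
  have huw : T.Adj u (p.getVert 1) := by
    simpa using p.adj_getVert_succ (i := 0) (by lia)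
  have hwv : T.Adj (p.getVert 1) v := by
    have := p.adj_getVert_succ (i := 1) (by lia)
    rwa [p.getVert_of_length_le (i := 1 + 1) (by lia)] at this
  generalize p.getVert 1 = w at huw hwv
  have hu := hT.dist_eq_dist_add_one_of_adj t huw
  have hv := hT.dist_eq_dist_add_one_of_adj t hwv
  have huv' := huv.diff_dist_adj (u := t)
  simp only [dist_comm (u := t), ← hdist] at hu hv huv'
  by_cases hwu : T.dist w t ≤ T.dist u t
  · rw [← hT.eq_parent_of_adj_of_dist_le hparent huw hwu,
      ← hT.eq_parent_of_adj_of_dist_le hparent hwv.symm (by lia)]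
  · have hu' := hT.eq_parent_of_adj_of_dist_le hparent huw.symm (by lia)
    have hv' := hT.eq_parent_of_adj_of_dist_le hparent hwv (by lia)
    exact absurd (hu'.trans hv'.symm) huv.ne

/-- If all cycles of `G` are triangles, then a vertex has at most one neighbor in `G` outside a
BFS tree. -/
lemma eq_of_adj_of_cycles_length_le_three (hTG : T ≤ G) (hT : T.IsTree)
    (hdist : ∀ v, T.dist v t = G.dist v t)
    (hparent : ∀ v, v ≠ t → T.Adj v (parent v) ∧ T.dist (parent v) t + 1 = T.dist v t)
    (hc : ∀ (w : V) (c : G.Walk w w), c.IsCycle → c.length ≤ 3)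
    {v a b : V} (ha : G.Adj v a) (hna : ¬ T.Adj v a) (hb : G.Adj v b) (hnb : ¬ T.Adj v b) :
    a = b := by
  by_contra hab
  have hpa := parent_eq_of_cycles_length_le_three hTG hT hdist hparent hc ha hna
  have hpb := parent_eq_of_cycles_length_le_three hTG hT hdist hparent hc hb hnb
  have hv := (hparent v (ne_root_of_adj_of_not_adj hdist ha.symm (mt Adj.symm hna))).1
  have hap := (hparent a (ne_root_of_adj_of_not_adj hdist ha hna)).1
  have hbp := (hparent b (ne_root_of_adj_of_not_adj hdist hb hnb)).1
  rw [← hpa] at hap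
  rw [← hpb] at hbp
  generalize parent v = p at hv hap hbp
  have hcyc : (Walk.cons ha (.cons (hTG hap) (.cons (hTG hbp.symm)
      (.cons hb.symm .nil)))).IsCycle := by
    rw [Walk.cons_isCycle_iff]
    have := ha.ne
    have := hb.ne
    have := hv.ne
    have := hap.ne
    have := hbp.ne
    simp [Walk.isPath_def]
    grind
  have := hc _ _ hcyc
  simp at this

/-- Suppose edges outside a BFS tree join siblings and form a matching. Then a cycle based at a
vertex of maximal depth, starting with an edge outside the tree, is a triangle. -/
lemma Walk.IsCycle.length_le_three_of_not_adj_snd (hT : T.IsTree)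
    (hdist : ∀ v, T.dist v t = G.dist v t)
    (hparent : ∀ v, v ≠ t → T.Adj v (parent v) ∧ T.dist (parent v) t + 1 = T.dist v t)
    (hsib : ∀ u v, G.Adj u v → ¬ T.Adj u v → parent u = parent v)
    (hmatch : ∀ v a b, G.Adj v a → ¬ T.Adj v a → G.Adj v b → ¬ T.Adj v b → a = b)
    {x : V} {c : G.Walk x x} (hc : c.IsCycle)
    (hmax : ∀ y ∈ c.support, T.dist y t ≤ T.dist x t) (hsnd : ¬ T.Adj x c.snd) :
    c.length ≤ 3 := by
  have hlen := hc.three_le_length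
  have hxz : G.Adj x c.snd := c.adj_snd hc.not_nil
  have hzw : G.Adj c.snd (c.getVert 2) := c.adj_getVert_succ (i := 1) (by lia)
  have hxy : G.Adj x c.penultimate := (c.adj_penultimate hc.not_nil).symm
  have hp := hsib _ _ hxz hsnd
  have hdz : T.dist c.snd t = T.dist x t := by
    rw [← (hparent _ (ne_root_of_adj_of_not_adj hdist hxz hsnd)).2,
      ← (hparent x (ne_root_of_adj_of_not_adj hdist hxz.symm (mt Adj.symm hsnd))).2, hp]
  have hw : c.getVert 2 = parent c.snd := by
    by_cases h : T.Adj c.snd (c.getVert 2)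
    · exact hT.eq_parent_of_adj_of_dist_le hparent h
        ((hmax _ (c.getVert_mem_support 2)).trans hdz.ge)
    · have hx : x = c.getVert 2 := hmatch _ _ _ hxz.symm (mt Adj.symm hsnd) hzw h
      have := hc.getVert_injOn' (x₁ := 0) (x₂ := 2) (by simp) (by simp; lia) (by simpa using hx)
      lia
  have hy : c.penultimate = parent x := by
    by_cases h : T.Adj x c.penultimate
    · exact hT.eq_parent_of_adj_of_dist_le hparent h (hmax _ (c.getVert_mem_support _))
    · exact absurd (hmatch _ _ _ hxz hsnd hxy h) hc.snd_ne_penultimate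
  have := hc.getVert_injOn (x₁ := 2) (x₂ := c.length - 1) (by simp; lia) (by simp; lia)
    (hw.trans (hp.symm.trans hy.symm))
  lia

/-- If edges outside a BFS tree join siblings and form a matching, all cycles are triangles. -/
lemma Walk.IsCycle.length_le_three (hT : T.IsTree)
    (hdist : ∀ v, T.dist v t = G.dist v t)
    (hparent : ∀ v, v ≠ t → T.Adj v (parent v) ∧ T.dist (parent v) t + 1 = T.dist v t)
    (hsib : ∀ u v, G.Adj u v → ¬ T.Adj u v → parent u = parent v)
    (hmatch : ∀ v a b, G.Adj v a → ¬ T.Adj v a → G.Adj v b → ¬ T.Adj v b → a = b)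
    {w : V} {c : G.Walk w w} (hc : c.IsCycle) : c.length ≤ 3 := by
  classical
  obtain ⟨x, hx, hmax⟩ := c.support.toFinset.exists_max_image (T.dist · t) ⟨w, by simp⟩
  rw [List.mem_toFinset] at hx
  replace hmax : ∀ y ∈ (c.rotate x hx).support, T.dist y t ≤ T.dist x t := fun y hy ↦
    hmax y (by simpa using hy)
  rw [← c.length_rotate x hx]
  replace hc := hc.rotate hx
  generalize c.rotate x hx = d at hc hmax
  by_cases hsnd : T.Adj x d.snd
  · by_cases hpen : T.Adj x d.penultimate
    · have h₁ := hT.eq_parent_of_adj_of_dist_le hparent hsnd (hmax _ (d.getVert_mem_support _))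
      have h₂ := hT.eq_parent_of_adj_of_dist_le hparent hpen (hmax _ (d.getVert_mem_support _))
      exact absurd (h₁.trans h₂.symm) hc.snd_ne_penultimate
    · rw [← d.length_reverse]
      exact hc.reverse.length_le_three_of_not_adj_snd hT hdist hparent hsib hmatch
        (by simpa using hmax) (by simpa using hpen)
  · exact hc.length_le_three_of_not_adj_snd hT hdist hparent hsib hmatch hmax hsnd

end SimpleGraph


/-- Let `G` be a finite connected simple graph, `t` a vertex and `T` a spanning
tree of `G` that preserves all distances to `t` (a BFS tree rooted at `t`), with
`parent v` the neighbor of `v` in `T` on the unique `T`-path from `v` to `t`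
(for `v ≠ t`).  Then every simple cycle of `G` has length at most `3` if and only
if (i) every edge of `G` not in `T` joins two vertices with the same parent and
(ii) every vertex is incident to at most one edge of `G` not in `T`. -/
theorem cycles_le_three_iff_bfs_tree_condition {V : Type*} [Fintype V]
    (G : SimpleGraph V) (hG : G.Connected) (t : V)
    (T : SimpleGraph V) (hTG : T ≤ G) (hT : T.IsTree)
    (hdist : ∀ v : V, T.dist v t = G.dist v t)
    (parent : V → V)
    (hparent : ∀ v : V, v ≠ t → T.Adj v (parent v) ∧ T.dist (parent v) t + 1 = T.dist v t) :
    (∀ (w : V) (c : G.Walk w w), c.IsCycle → c.length ≤ 3) ↔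
      ((∀ u v : V, G.Adj u v → ¬ T.Adj u v → parent u = parent v) ∧
       (∀ v : V, ∀ e₁ ∈ G.edgeSet \ T.edgeSet, ∀ e₂ ∈ G.edgeSet \ T.edgeSet,
          v ∈ e₁ → v ∈ e₂ → e₁ = e₂)) := by
  constructor
  · refine fun hc ↦ ⟨fun u v ↦
      SimpleGraph.parent_eq_of_cycles_length_le_three hTG hT hdist hparent hc, ?_⟩
    rintro v e₁ ⟨h₁, h₁'⟩ e₂ ⟨h₂, h₂'⟩ hv₁ hv₂
    obtain ⟨a, rfl⟩ := hv₁
    obtain ⟨b, rfl⟩ := hv₂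
    exact congrArg (s(v, ·)) (SimpleGraph.eq_of_adj_of_cycles_length_le_three hTG hT hdist hparent
      hc h₁ h₁' h₂ h₂')
  · rintro ⟨hsib, hmatch⟩ w c hc
    refine hc.length_le_three hT hdist hparent hsib fun v a b ha hna hb hnb ↦ ?_
    exact Sym2.congr_right.1 (hmatch v s(v, a) ⟨ha, hna⟩ s(v, b) ⟨hb, hnb⟩
      (Sym2.mem_mk_left v a) (Sym2.mem_mk_left v b))
end
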